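/- arXiv:1401.0625 — 3 statements merged into one kernel-verified Lean document; each statement's English description precedes it below -/
import Mathlib

section
/- Let u, v, w be finite strings over a linearly ordered alphabet with u ≤ v ≤ w in lexicographic order. Then lcp(u, w) = min(lcp(u, v), lcp(v, w)), where lcp(a, b) denotes the length of the longest common prefix of a and b. -/
/-- `lcp a b` is the length of the longest common prefix of the strings
(lists) `a` and `b`. -/
def lcp {α : Type} [DecidableEq α] : List α → List α → ℕ
  | a :: as, b :: bs => if a = b then lcp as bs + 1 else 0
  | _, _ => 0

/-- For strings `u ≤ v ≤ w` in lexicographic order,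
`lcp(u, w) = min(lcp(u, v), lcp(v, w))`. -/
theorem stmt5 {α : Type} [LinearOrder α] (u v w : List α)
    (huv : u ≤ v) (hvw : v ≤ w) :
    lcp u w = min (lcp u v) (lcp v w) := by
  have key : ∀ {a b : α} {s t : List α}, a :: s ≤ b :: t → a < b ∨ (a = b ∧ s ≤ t) := by
    intro a b s t h
    rcases h.eq_or_lt with h | h
    · simp only [List.cons.injEq] at h
      exact Or.inr ⟨h.1, h.2.le⟩
    · rcases List.cons_lt_cons_iff.1 h with h | ⟨h, h'⟩
      · exact Or.inl h
      · exact Or.inr ⟨h, le_of_lt h'⟩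
  induction u generalizing v w with
  | nil => simp [lcp]
  | cons a u ih =>
    cases v with
    | nil => exact absurd huv (not_le_of_gt (List.nil_lt_cons a u))
    | cons b v =>
      cases w with
      | nil => exact absurd hvw (not_le_of_gt (List.nil_lt_cons b v))
      | cons c w =>
        replace huv := key huv
        replace hvw := key hvw
        simp only [lcp]
        rcases huv with h1 | ⟨rfl, h1⟩
        · have hac : a ≠ c := by
            rcases hvw with h2 | ⟨rfl, h2⟩
            · exact (h1.trans h2).ne
            · exact h1.ne
          simp [h1.ne, hac]
        · rcases hvw with h2 | ⟨rfl, h2⟩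
          · simp [h2.ne]
          · simp [ih v w h1 h2]
end

section
/- Let s₀ ≤ s₁ ≤ … ≤ sₘ (m ≥ 1) be finite strings over a linearly ordered alphabet, sorted in lexicographic order. Then lcp(s₀, sₘ) = min over 0 ≤ i < m of lcp(sᵢ, sᵢ₊₁), where lcp(a, b) denotes the length of the longest common prefix of a and b. -/
theorem list_le_iff {α : Type} [LinearOrder α] (a b : List α) :
    a ≤ b ↔ a = b ∨ List.Lex (· < ·) a b := Iff.rfl

theorem cons_le_cons_iff_aux {α : Type} [LinearOrder α] {x y : α} {a b : List α}
    (h : x :: a ≤ y :: b) : x < y ∨ x = y ∧ a ≤ b := by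
  rw [list_le_iff] at h
  rw [list_le_iff]
  rcases h with h | h
  · injection h with h1 h2
    exact Or.inr ⟨h1, Or.inl h2⟩
  · cases h with
    | cons h => exact Or.inr ⟨rfl, Or.inr h⟩
    | rel h => exact Or.inl h

theorem not_cons_le_nil_aux {α : Type} [LinearOrder α] {x : α} {a : List α}
    (h : x :: a ≤ []) : False := by
  rw [list_le_iff] at h
  rcases h with h | h
  · cases h
  · cases h

theorem lcp_min {α : Type} [LinearOrder α] : ∀ a b c : List α, a ≤ b → b ≤ c →
    lcp a c = min (lcp a b) (lcp b c)
  | [], b, c, _, _ => by simp [lcp]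
  | x :: a, [], c, h, _ => (not_cons_le_nil_aux h).elim
  | x :: a, y :: b, [], _, h => (not_cons_le_nil_aux h).elim
  | x :: a, y :: b, z :: c, h1, h2 => by
    replace h1 := cons_le_cons_iff_aux h1
    replace h2 := cons_le_cons_iff_aux h2
    have ih := lcp_min a b c
    simp only [lcp]
    rcases h1 with h1 | ⟨rfl, h1⟩
    · have hxz : x ≠ z := by
        rcases h2 with h2 | ⟨rfl, h2⟩
        · exact (h1.trans h2).ne
        · exact h1.ne
      simp [h1.ne, hxz]
    · rcases h2 with h2 | ⟨rfl, h2⟩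
      · simp [h2.ne]
      · simp [ih h1 h2]

theorem lcp_chain {α : Type} [LinearOrder α] (s : ℕ → List α) (n : ℕ)
    (hs : ∀ i : ℕ, i < n + 1 → s i ≤ s (i + 1)) :
    s 0 ≤ s (n + 1) ∧ lcp (s 0) (s (n + 1))
      = (Finset.range (n + 1)).inf' Finset.nonempty_range_add_one
          (fun i => lcp (s i) (s (i + 1))) := by
  induction n with
  | zero => exact ⟨hs 0 (by omega), by simp⟩
  | succ n ih =>
    obtain ⟨h1, h2⟩ := ih (fun i hi => hs i (by omega))
    have h3 := hs (n + 1) (by omega)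
    refine ⟨le_trans h1 h3, ?_⟩
    rw [lcp_min _ _ _ h1 h3, h2]
    simp only [Finset.range_add_one (n := n + 1)]
    rw [Finset.inf'_insert Finset.nonempty_range_add_one]
    exact min_comm _ _

/-- For lexicographically sorted strings `s 0 ≤ s 1 ≤ … ≤ s m` with `m ≥ 1`,
`lcp(s 0, s m)` equals the minimum over `0 ≤ i < m` of `lcp(s i, s (i+1))`. -/
theorem stmt7 {α : Type} [LinearOrder α] (m : ℕ) (hm : 1 ≤ m)
    (s : ℕ → List α) (hs : ∀ i : ℕ, i < m → s i ≤ s (i + 1)) :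
    lcp (s 0) (s m)
      = (Finset.range m).inf' (Finset.nonempty_range_iff.mpr (by omega))
          (fun i => lcp (s i) (s (i + 1))) := by
  obtain ⟨n, rfl⟩ : ∃ n, m = n + 1 := ⟨m - 1, by omega⟩
  exact (lcp_chain s n hs).2
end

section
/- Let S be a finite nonempty set of strings over a linearly ordered alphabet and let P be a string. Then the maximum over s ∈ S of lcp(P, s) is attained either at the lexicographic predecessor of P in S (the largest element of S that is ≤ P) or at the lexicographic successor of P in S (the smallest element of S that is ≥ P), whichever exist. -/
theorem my_cons_le {α : Type} [LinearOrder α] {a b : α} {s t : List α} (h : a :: s ≤ b :: t) :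
    a < b ∨ a = b ∧ s ≤ t := by
  rw [le_iff_lt_or_eq] at h
  rcases h with h | h
  · replace h : List.Lex (· < ·) (a :: s) (b :: t) := h
    cases h with
    | cons h => exact Or.inr ⟨rfl, le_of_lt (α := List α) h⟩
    | rel h => exact Or.inl h
  · cases h
    exact Or.inr ⟨rfl, le_refl _⟩

theorem my_not_cons_le_nil {α : Type} [LinearOrder α] {a : α} {s : List α} : ¬ a :: s ≤ [] := by
  intro h
  rw [le_iff_lt_or_eq] at h
  rcases h with h | h
  · replace h : List.Lex (· < ·) (a :: s) [] := h
    cases h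
  · cases h

theorem lcp_mono_left {α : Type} [LinearOrder α] : ∀ (P s t : List α), s ≤ t → t ≤ P → lcp P s ≤ lcp P t
  | [], s, t, _, _ => by simp [lcp]
  | p :: P, [], t, _, _ => by simp [lcp]
  | p :: P, a :: s, [], h, _ => absurd h my_not_cons_le_nil
  | p :: P, a :: s, b :: t, h1, h2 => by
    have ih := lcp_mono_left P s t
    replace h1 := my_cons_le h1
    replace h2 := my_cons_le h2
    simp only [lcp]
    by_cases hpa : p = a
    · subst hpa
      rcases h1 with h1 | ⟨rfl, h1⟩ <;> rcases h2 with h2 | ⟨h2, h3⟩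
      · exact absurd h1 h2.not_gt
      · exact absurd h1 (by simp [h2])
      · exact absurd h2 (lt_irrefl _)
      · simpa using ih h1 h3
    · simp [hpa]

theorem lcp_mono_right {α : Type} [LinearOrder α] : ∀ (P s t : List α), P ≤ t → t ≤ s → lcp P s ≤ lcp P t
  | [], s, t, _, _ => by simp [lcp]
  | p :: P, [], t, _, _ => by simp [lcp]
  | p :: P, a :: s, [], h, _ => absurd h my_not_cons_le_nil
  | p :: P, a :: s, b :: t, h1, h2 => by
    have ih := lcp_mono_right P s t
    replace h1 := my_cons_le h1
    replace h2 := my_cons_le h2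
    simp only [lcp]
    by_cases hpa : p = a
    · subst hpa
      rcases h1 with h1 | ⟨rfl, h1⟩ <;> rcases h2 with h2 | ⟨h2, h3⟩
      · exact absurd h1 h2.not_gt
      · exact absurd h1 (by simp [h2])
      · exact absurd h2 (lt_irrefl _)
      · simpa using ih h1 h3
    · simp [hpa]

/-- For a finite nonempty set `S` of strings and a string `P`, the maximum of
`lcp(P, s)` over `s ∈ S` is attained either at the lexicographic predecessor
of `P` in `S` (the largest element of `S` that is `≤ P`) or at the
lexicographic successor of `P` in `S` (the smallest element of `S` that is
`≥ P`). -/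
theorem stmt8 {α : Type} [LinearOrder α] (S : Finset (List α)) (hS : S.Nonempty)
    (P : List α) :
    ∃ b ∈ S,
      ((b ≤ P ∧ ∀ t ∈ S, t ≤ P → t ≤ b) ∨ (P ≤ b ∧ ∀ t ∈ S, P ≤ t → b ≤ t)) ∧
      ∀ s ∈ S, lcp P s ≤ lcp P b := by
  obtain ⟨m, hm, hmax⟩ := S.exists_max_image (fun s => lcp P s) hS
  rcases le_total m P with h | h
  · obtain ⟨b, hb, hbm⟩ := (S.filter (fun t => t ≤ P)).exists_max_image id
      ⟨m, Finset.mem_filter.2 ⟨hm, h⟩⟩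
    rw [Finset.mem_filter] at hb
    refine ⟨b, hb.1, Or.inl ⟨hb.2, fun t ht htP => hbm t (Finset.mem_filter.2 ⟨ht, htP⟩)⟩, ?_⟩
    intro s hs
    exact (hmax s hs).trans (lcp_mono_left P m b (hbm m (Finset.mem_filter.2 ⟨hm, h⟩)) hb.2)
  · obtain ⟨b, hb, hbm⟩ := (S.filter (fun t => P ≤ t)).exists_min_image id
      ⟨m, Finset.mem_filter.2 ⟨hm, h⟩⟩
    rw [Finset.mem_filter] at hb
    refine ⟨b, hb.1, Or.inr ⟨hb.2, fun t ht htP => hbm t (Finset.mem_filter.2 ⟨ht, htP⟩)⟩, ?_⟩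
    intro s hs
    exact (hmax s hs).trans (lcp_mono_right P m b hb.2 (hbm m (Finset.mem_filter.2 ⟨hm, h⟩)))
end
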